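/- Let (g,⟨·,·⟩) be a metric Lie algebra with dim g = 3, and suppose the inner product is not bi-invariant, i.e. there exists X₀ ∈ g such that ad_{X₀} is not skew-adjoint with respect to ⟨·,·⟩ (in dimension 3 this holds exactly when g is neither abelian nor isomorphic to so(3) with a bi-invariant inner product). Then the Euler equation has an unstable stationary point. -/

import Mathlib

open scoped InnerProductSpace

/-- A Lie algebra structure (a bilinear Lie bracket) on the real inner product space `g`,
making `(g, ⟨·,·⟩)` a metric Lie algebra. -/
structure LieStructure (g : Type*) [NormedAddCommGroup g] [InnerProductSpace ℝ g] where
  bracket : g →ₗ[ℝ] g →ₗ[ℝ] g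
  bracket_self : ∀ x, bracket x x = 0
  jacobi : ∀ x y z, bracket x (bracket y z) + bracket y (bracket z x) + bracket z (bracket x y) = 0

namespace LieStructure

variable {g : Type*} [NormedAddCommGroup g] [InnerProductSpace ℝ g] [FiniteDimensional ℝ g]
variable (L : LieStructure g)

/-- `ad_Y : Z ↦ [Y, Z]`. -/
def ad (Y : g) : g →ₗ[ℝ] g := L.bracket Y

/-- `ad_Yᵗ`, the adjoint of `ad_Y` with respect to the inner product. -/
noncomputable def adT (Y : g) : g →ₗ[ℝ] g := LinearMap.adjoint (L.ad Y)

/-- A solution of the Euler equation `Ẏ = ad_Yᵗ Y`. -/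
def IsSolution (Y : ℝ → g) : Prop := ∀ t : ℝ, HasDerivAt Y (L.adT (Y t) (Y t)) t

/-- A stationary point (equilibrium) of the Euler equation: `ad_Xᵗ X = 0`. -/
def IsStationary (X : g) : Prop := L.adT X X = 0

/-- Lyapunov stability of a point `X` for the Euler equation: every solution starting
close to `X` remains close to `X` for all `t ≥ 0`. -/
def IsStable (X : g) : Prop :=
  ∀ ε > 0, ∃ δ > 0, ∀ Y : ℝ → g, L.IsSolution Y → ‖Y 0 - X‖ < δ → ∀ t ≥ 0, ‖Y t - X‖ < ε

/-- The linearisation `J_X : Y ↦ ad_Xᵗ Y + ad_Yᵗ X` of the Euler equation at `X`. -/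
noncomputable def J (X : g) : g →ₗ[ℝ] g where
  toFun Y := L.adT X Y + L.adT Y X
  map_add' Y Z := by
    simp only [adT, ad, map_add, LinearMap.add_apply]
    abel
  map_smul' c Y := by
    simp only [adT, ad, map_smul, map_smulₛₗ, starRingEnd_apply, star_trivial,
      LinearMap.smul_apply, RingHom.id_apply, smul_add]

/-- `g` is unimodular: `Tr (ad_X) = 0` for all `X`. -/
def IsUnimodular : Prop := ∀ X : g, LinearMap.trace ℝ g (L.ad X) = 0

/-- The centre of `g`: the set of `X` with `[X, ·] = 0`. -/
def center : Submodule ℝ g := LinearMap.ker L.bracket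

end LieStructure

/-- `σ_k(J)`: the `k`-th elementary symmetric function of the eigenvalues of `J`, i.e.
`(-1)^k` times the coefficient of `λ^(n-k)` in the characteristic polynomial
`det (λ·id - J)` of `J`, where `n = dim g`. -/
noncomputable def sigmaCoeff {g : Type*} [NormedAddCommGroup g] [InnerProductSpace ℝ g]
    [FiniteDimensional ℝ g] (k : ℕ) (J : g →ₗ[ℝ] g) : ℝ :=
  (-1 : ℝ) ^ k * (LinearMap.charpoly J).coeff (Module.finrank ℝ g - k)

open Set Manifold in
/-- A bounded `C¹` vector field on a finite-dimensional space is complete. -/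
theorem exists_global_integralCurve_of_bounded {E : Type*} [NormedAddCommGroup E]
    [NormedSpace ℝ E] [FiniteDimensional ℝ E] {f : E → E} (hf : ContDiff ℝ 1 f) {C : ℝ}
    (hC : ∀ x, ‖f x‖ ≤ C) (x₀ : E) :
    ∃ γ : ℝ → E, γ 0 = x₀ ∧ ∀ t, HasDerivAt γ (f (γ t)) t := by
  have : CompleteSpace E := FiniteDimensional.complete ℝ E
  have : ProperSpace E := FiniteDimensional.proper ℝ E
  lift C to NNReal using (norm_nonneg _).trans (hC x₀)
  have hlocal : ∀ x : E, ∃ γ : ℝ → E, γ 0 = x ∧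
      IsMIntegralCurveOn (I := 𝓘(ℝ, E)) γ (fun x ↦ (f x : TangentSpace 𝓘(ℝ, E) x))
        (Ioo (-1) 1) := by
    intro x
    obtain ⟨K, hK⟩ := (hf.contDiffOn (s := Metric.closedBall x C)).exists_lipschitzOnWith
      one_ne_zero (convex_closedBall x C) (isCompact_closedBall x C)
    have hpl : IsPicardLindelof (fun _ ↦ f) (tmin := -1) (tmax := 1) ⟨0, by norm_num⟩ x C 0 C K :=
      { lipschitzOnWith := fun _ _ ↦ hK
        continuousOn := fun _ _ ↦ continuousOn_const
        norm_le := fun _ _ y _ ↦ hC y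
        mul_max_le := by simp }
    obtain ⟨γ, h0, hγ⟩ := hpl.exists_eq_forall_mem_Icc_hasDerivWithinAt₀
    refine ⟨γ, h0, fun t ht ↦ HasMFDerivAt.hasMFDerivWithinAt ?_⟩
    exact ((hγ t (Ioo_subset_Icc_self ht)).hasDerivAt (Icc_mem_nhds ht.1 ht.2)).hasFDerivAt.hasMFDerivAt
  obtain ⟨γ, h0, hγ⟩ := exists_isMIntegralCurve_of_isMIntegralCurveOn (I := 𝓘(ℝ, E))
    (contMDiff_vectorSpace_iff_contDiff.2 hf) one_pos hlocal x₀
  exact ⟨γ, h0, fun t ↦ hasDerivAt_iff_hasFDerivAt.2 (hasMFDerivAt_iff_hasFDerivAt.1 (hγ t))⟩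

namespace LieStructure

variable {g : Type*} [NormedAddCommGroup g] [InnerProductSpace ℝ g]

theorem bracket_swap (L : LieStructure g) (x y : g) : L.bracket y x = -L.bracket x y := by
  have h := L.bracket_self (x + y)
  simp only [map_add, LinearMap.add_apply, L.bracket_self, zero_add, add_zero] at h
  exact eq_neg_of_add_eq_zero_left h

variable [FiniteDimensional ℝ g] (L : LieStructure g)

theorem inner_adT (X Y Z : g) : ⟪L.adT X Y, Z⟫_ℝ = ⟪Y, L.bracket X Z⟫_ℝ :=
  LinearMap.adjoint_inner_left _ _ _

theorem inner_adT_self (Y : g) : ⟪L.adT Y Y, Y⟫_ℝ = 0 := by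
  rw [inner_adT, L.bracket_self, inner_zero_right]

theorem adT_self_eq_sum {ι : Type*} [Fintype ι] (b : OrthonormalBasis ι ℝ g) (Y : g) :
    L.adT Y Y = ∑ i, ⟪Y, L.bracket Y (b i)⟫_ℝ • b i := by
  conv_lhs => rw [← b.sum_repr' (L.adT Y Y)]
  simp_rw [real_inner_comm, inner_adT]

theorem contDiff_adT_self : ContDiff ℝ 1 fun Y ↦ L.adT Y Y := by
  simp_rw [L.adT_self_eq_sum (stdOrthonormalBasis ℝ g)]
  refine ContDiff.sum fun i _ ↦ ContDiff.smul (contDiff_id.inner ℝ ?_) contDiff_const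
  exact (LinearMap.toContinuousLinearMap (L.bracket.flip (stdOrthonormalBasis ℝ g i))).contDiff

theorem exists_norm_adT_self_le : ∃ C, ∀ Y, ‖L.adT Y Y‖ ≤ C * ‖Y‖ ^ 2 := by
  refine ⟨∑ i, ‖LinearMap.toContinuousLinearMap (L.bracket.flip (stdOrthonormalBasis ℝ g i))‖,
    fun Y ↦ ?_⟩
  rw [L.adT_self_eq_sum (stdOrthonormalBasis ℝ g), Finset.sum_mul]
  refine norm_sum_le_of_le _ fun i _ ↦ ?_
  rw [norm_smul, OrthonormalBasis.norm_eq_one, mul_one]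
  have h := (LinearMap.toContinuousLinearMap
    (L.bracket.flip (stdOrthonormalBasis ℝ g i))).le_opNorm Y
  calc ‖⟪Y, L.bracket Y (stdOrthonormalBasis ℝ g i)⟫_ℝ‖
      ≤ ‖Y‖ * ‖L.bracket Y (stdOrthonormalBasis ℝ g i)‖ := norm_inner_le_norm _ _
    _ ≤ ‖Y‖ * (_ * ‖Y‖) := mul_le_mul_of_nonneg_left h (norm_nonneg _)
    _ = _ := by ring

/-- The Euler equation is complete: the norm is conserved. -/
theorem exists_isSolution (Y₀ : g) : ∃ Y, L.IsSolution Y ∧ Y 0 = Y₀ := by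
  obtain ⟨C, hC⟩ := L.exists_norm_adT_self_le
  have hpos : ∀ Y : g, 0 < 1 + ‖Y‖ ^ 2 := fun Y ↦ by positivity
  have hf : ContDiff ℝ 1 fun Y ↦ (1 + ‖Y‖ ^ 2)⁻¹ • L.adT Y Y :=
    ((contDiff_const.add (contDiff_norm_sq ℝ)).inv fun Y ↦ (hpos Y).ne').smul L.contDiff_adT_self
  obtain ⟨γ, h0, hγ⟩ := exists_global_integralCurve_of_bounded hf (C := |C|) (fun Y ↦ by
    rw [norm_smul, norm_inv, Real.norm_of_nonneg (hpos Y).le, inv_mul_le_iff₀ (hpos Y)]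
    nlinarith [hC Y, le_abs_self C, abs_nonneg C, sq_nonneg ‖Y‖]) Y₀
  have hnorm : ∀ t, ‖γ t‖ ^ 2 = ‖Y₀‖ ^ 2 := by
    intro t
    have hd : ∀ s, HasDerivAt (fun s ↦ ‖γ s‖ ^ 2) 0 s := fun s ↦ by
      refine (hγ s).norm_sq.congr_deriv ?_
      rw [real_inner_comm, real_inner_smul_left, inner_adT_self]
      simp
    rw [is_const_of_deriv_eq_zero (fun s ↦ (hd s).differentiableAt) (fun s ↦ (hd s).deriv) t 0, h0]
  refine ⟨fun t ↦ γ ((1 + ‖Y₀‖ ^ 2) * t), fun t ↦ ?_, by simpa using h0⟩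
  refine ((hγ _).scomp t ((hasDerivAt_id t).const_mul (1 + ‖Y₀‖ ^ 2))).congr_deriv ?_
  rw [hnorm, mul_one, smul_inv_smul₀ (hpos Y₀).ne']
  rfl

/-- An instability criterion: near `X`, the function `P` grows exponentially along solutions, and
there are points arbitrarily close to `X` at which it does not vanish. -/
theorem not_isStable_of_growth {X w : g} {P κ : g → ℝ} {c ε : ℝ} (hε : 0 < ε) (hc : 0 < c)
    (hP : Continuous P)
    (hderiv : ∀ Y, L.IsSolution Y → ∀ t, HasDerivAt (fun t ↦ P (Y t)) (κ (Y t) * P (Y t)) t)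
    (hκ : ∀ y, ‖y - X‖ < ε → c ≤ κ y) (hw : ∀ s : ℝ, s ≠ 0 → P (X + s • w) ≠ 0) :
    ¬ L.IsStable X := by
  intro hst
  obtain ⟨δ, hδ, hst⟩ := hst ε hε
  obtain ⟨s, hs, hsδ⟩ : ∃ s : ℝ, s ≠ 0 ∧ ‖s • w‖ < δ := by
    refine ⟨δ / (‖w‖ + 1), by positivity, ?_⟩
    rw [norm_smul, Real.norm_of_nonneg (by positivity), div_mul_eq_mul_div,
      div_lt_iff₀ (by positivity)]
    nlinarith
  obtain ⟨Y, hY, hY0⟩ := L.exists_isSolution (X + s • w)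
  have hnear := hst Y hY (by simpa [hY0] using hsδ)
  have hp0 : 0 < P (Y 0) ^ 2 := by
    have := hw s hs
    rw [hY0]; positivity
  have : ProperSpace g := FiniteDimensional.proper ℝ g
  obtain ⟨B, hB⟩ := (isCompact_closedBall X ε).exists_bound_of_continuousOn
    (hP.pow 2).continuousOn
  have hd : ∀ t, HasDerivAt (fun t ↦ P (Y t) ^ 2 * Real.exp (-(2 * c * t)))
      (2 * (κ (Y t) - c) * P (Y t) ^ 2 * Real.exp (-(2 * c * t))) t := by
    intro t
    have he : HasDerivAt (fun t ↦ Real.exp (-(2 * c * t)))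
        (Real.exp (-(2 * c * t)) * -(2 * c * 1)) t :=
      ((hasDerivAt_id t).const_mul (2 * c)).neg.exp
    refine (((hderiv Y hY t).pow 2).mul he).congr_deriv ?_
    push_cast
    simp only [Pi.pow_apply]
    ring
  have hmono : MonotoneOn (fun t ↦ P (Y t) ^ 2 * Real.exp (-(2 * c * t))) (Set.Ici 0) := by
    refine monotoneOn_of_deriv_nonneg (convex_Ici 0)
      (fun t _ ↦ (hd t).continuousAt.continuousWithinAt)
      (fun t _ ↦ (hd t).differentiableAt.differentiableWithinAt) fun t ht ↦ ?_
    rw [interior_Ici, Set.mem_Ioi] at ht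
    rw [(hd t).deriv]
    have := sub_nonneg.2 (hκ _ (hnear t ht.le))
    positivity
  obtain ⟨t, ht0, ht⟩ : ∃ t : ℝ, 0 ≤ t ∧ B < P (Y 0) ^ 2 * (2 * c * t) := by
    refine ⟨(|B| + 1) / (P (Y 0) ^ 2 * (2 * c)), by positivity, ?_⟩
    rw [← mul_assoc, mul_div_cancel₀ _ (by positivity)]
    linarith [le_abs_self B]
  have h1 := hmono Set.self_mem_Ici ht0 ht0
  simp only [mul_zero, neg_zero, Real.exp_zero, mul_one] at h1
  have h2 := hB (Y t) (by simpa [dist_eq_norm] using (hnear t ht0).le)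
  rw [Pi.pow_apply, Real.norm_of_nonneg (sq_nonneg _)] at h2
  rw [Real.exp_neg, ← div_eq_mul_inv, le_div_iff₀ (Real.exp_pos _)] at h1
  nlinarith [Real.add_one_le_exp (2 * c * t)]

/-- The coordinates of a solution of the Euler equation. -/
theorem IsSolution.hasDerivAt_inner {L : LieStructure g} {Y : ℝ → g} (hY : L.IsSolution Y) (e : g)
    (t : ℝ) : HasDerivAt (fun t ↦ ⟪e, Y t⟫_ℝ) ⟪Y t, L.bracket (Y t) e⟫_ℝ t := by
  refine ((hasDerivAt_const t e).inner ℝ (hY t)).congr_deriv ?_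
  rw [inner_zero_left, add_zero, real_inner_comm, inner_adT]

end LieStructure

namespace LieStructure

variable {g : Type*} [NormedAddCommGroup g] [InnerProductSpace ℝ g]

theorem inner_bracket_eq_sum (L : LieStructure g) {ι : Type*} [Fintype ι]
    (b : OrthonormalBasis ι ℝ g) (X Y Z : g) :
    ⟪Z, L.bracket X Y⟫_ℝ =
      ∑ i, ∑ j, ⟪b i, X⟫_ℝ * (⟪b j, Y⟫_ℝ * ⟪Z, L.bracket (b i) (b j)⟫_ℝ) := by
  conv_lhs => rw [← b.sum_repr' X, ← b.sum_repr' Y]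
  simp only [map_sum, map_smul, LinearMap.sum_apply, LinearMap.smul_apply, inner_sum,
    real_inner_smul_right, Finset.mul_sum]
  refine Finset.sum_comm.trans (Finset.sum_congr rfl fun i _ ↦ Finset.sum_congr rfl fun j _ ↦ ?_)
  ring

/-- A Milnor frame: an orthonormal basis `b` with `[b₁, b₂] = l₀ b₀` and cyclically. -/
structure IsMilnorFrame (L : LieStructure g) (b : OrthonormalBasis (Fin 3) ℝ g)
    (l : Fin 3 → ℝ) : Prop where
  bracket_one_two : L.bracket (b 1) (b 2) = l 0 • b 0
  bracket_two_zero : L.bracket (b 2) (b 0) = l 1 • b 1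
  bracket_zero_one : L.bracket (b 0) (b 1) = l 2 • b 2

namespace IsMilnorFrame

variable {L : LieStructure g} {b : OrthonormalBasis (Fin 3) ℝ g} {l : Fin 3 → ℝ}

theorem inner_bracket (h : L.IsMilnorFrame b l) (X Y Z : g) :
    ⟪Z, L.bracket X Y⟫_ℝ =
      l 0 * (⟪b 1, X⟫_ℝ * ⟪b 2, Y⟫_ℝ - ⟪b 2, X⟫_ℝ * ⟪b 1, Y⟫_ℝ) * ⟪b 0, Z⟫_ℝ +
      l 1 * (⟪b 2, X⟫_ℝ * ⟪b 0, Y⟫_ℝ - ⟪b 0, X⟫_ℝ * ⟪b 2, Y⟫_ℝ) * ⟪b 1, Z⟫_ℝ +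
      l 2 * (⟪b 0, X⟫_ℝ * ⟪b 1, Y⟫_ℝ - ⟪b 1, X⟫_ℝ * ⟪b 0, Y⟫_ℝ) * ⟪b 2, Z⟫_ℝ := by
  rw [L.inner_bracket_eq_sum b]
  simp only [Fin.sum_univ_three, L.bracket_self, L.bracket_swap (b 1) (b 2),
    L.bracket_swap (b 2) (b 0), L.bracket_swap (b 0) (b 1), h.bracket_one_two, h.bracket_two_zero,
    h.bracket_zero_one, inner_neg_right, real_inner_smul_right, inner_zero_right,
    real_inner_comm Z]
  ring

theorem rotate (h : L.IsMilnorFrame b l) :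
    L.IsMilnorFrame (b.reindex (finRotate 3)) (l ∘ (finRotate 3).symm) where
  bracket_one_two := by simpa [show (-1 : Fin 3) = 2 from rfl] using h.bracket_zero_one
  bracket_two_zero := by simpa [show (-1 : Fin 3) = 2 from rfl] using h.bracket_one_two
  bracket_zero_one := by simpa [show (-1 : Fin 3) = 2 from rfl] using h.bracket_two_zero

variable [FiniteDimensional ℝ g]

theorem isStationary_one (h : L.IsMilnorFrame b l) : L.IsStationary (b 1) := by
  rw [IsStationary, L.adT_self_eq_sum b]
  simp [h.inner_bracket, OrthonormalBasis.inner_eq_ite]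

/-- Rotation about the middle axis is unstable. -/
theorem not_isStable_one_of_middle (h : L.IsMilnorFrame b l)
    (hl : 0 < (l 0 - l 1) * (l 1 - l 2)) : ¬ L.IsStable (b 1) := by
  set k := √((l 0 - l 1) * (l 1 - l 2)) with hk
  have hkk : k ^ 2 = (l 0 - l 1) * (l 1 - l 2) := Real.sq_sqrt hl.le
  have hk0 : 0 < k := Real.sqrt_pos.2 hl
  refine L.not_isStable_of_growth (w := b 0) (c := k / 2) (ε := 1 / 2)
    (P := fun Y ↦ (l 0 - l 1) * ⟪b 0, Y⟫_ℝ + k * ⟪b 2, Y⟫_ℝ) (κ := fun Y ↦ k * ⟪b 1, Y⟫_ℝ)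
    (by norm_num) (by positivity) (by fun_prop) (fun Y hY t ↦ ?_) (fun y hy ↦ ?_) fun s hs ↦ ?_
  · refine (((hY.hasDerivAt_inner (b 0) t).const_mul _).add
      ((hY.hasDerivAt_inner (b 2) t).const_mul _)).congr_deriv ?_
    simp only [h.inner_bracket, OrthonormalBasis.inner_eq_ite]
    simp
    linear_combination (-⟪b 1, Y t⟫_ℝ * ⟪b 2, Y t⟫_ℝ) * hkk
  · have h1 := (abs_real_inner_le_norm (b 1) (y - b 1)).trans_lt (by simpa using hy)
    rw [inner_sub_right, real_inner_self_eq_norm_sq, b.norm_eq_one] at h1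
    nlinarith [(abs_lt.1 h1).1]
  · simp only [inner_add_right, real_inner_smul_right, OrthonormalBasis.inner_eq_ite]
    simpa [hs] using left_ne_zero_of_mul hl.ne'

/-- In a degenerate Milnor frame, points near a double axis rotate along a whole circle. -/
theorem not_isStable_one_of_eq (h : L.IsMilnorFrame b l) (h12 : l 1 = l 2) (h01 : l 0 ≠ l 1) :
    ¬ L.IsStable (b 1) := by
  intro hst
  obtain ⟨δ, hδ, hst⟩ := hst 1 one_pos
  set ω := (l 1 - l 0) * (δ / 2) with hω
  have hω0 : ω ≠ 0 := mul_ne_zero (sub_ne_zero.2 h01.symm) (by positivity)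
  let Y : ℝ → g := fun t ↦ (δ / 2) • b 0 + (Real.cos (ω * t) • b 1 + -Real.sin (ω * t) • b 2)
  have hlin : ∀ t, HasDerivAt (fun t ↦ ω * t) ω t := fun t ↦ by
    simpa using (hasDerivAt_id t).const_mul ω
  have hY : L.IsSolution Y := fun t ↦ by
    refine (((hlin t).cos.smul_const (b 1)).add
      ((hlin t).sin.neg.smul_const (b 2))).const_add _ |>.congr_deriv ?_
    rw [L.adT_self_eq_sum b]
    simp only [h.inner_bracket, Fin.sum_univ_three, Y, inner_add_right, real_inner_smul_right,
      OrthonormalBasis.inner_eq_ite]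
    simp
    rw [← h12]
    module
  have h0 : ‖Y 0 - b 1‖ < δ := by
    simp [Y, norm_smul, abs_of_pos hδ]
    linarith
  have h1 := hst Y hY h0 (Real.pi / |ω|) (by positivity)
  have hcos : Real.cos (ω * (Real.pi / |ω|)) = -1 := by
    rw [← Real.cos_abs, abs_mul, abs_div, abs_abs, mul_div_cancel₀ _ (abs_ne_zero.2 hω0),
      Real.cos_abs, Real.cos_pi]
  have h2 := (abs_real_inner_le_norm (b 1) (Y (Real.pi / |ω|) - b 1)).trans_lt (by simpa using h1)
  simp only [Y, inner_sub_right, inner_add_right, real_inner_smul_right,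
    OrthonormalBasis.inner_eq_ite, hcos] at h2
  simp at h2
  norm_num at h2

theorem exists_unstable (h : L.IsMilnorFrame b l) (hl : 0 ≤ (l 0 - l 1) * (l 1 - l 2))
    (hne : l 0 ≠ l 1 ∨ l 1 ≠ l 2) : ∃ X, L.IsStationary X ∧ ¬ L.IsStable X := by
  rcases hl.lt_or_eq with hl | hl
  · exact ⟨_, h.isStationary_one, h.not_isStable_one_of_middle hl⟩
  rcases mul_eq_zero.1 hl.symm with h01 | h12
  · have h01 := sub_eq_zero.1 h01
    refine ⟨_, h.rotate.isStationary_one, h.rotate.not_isStable_one_of_eq ?_ ?_⟩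
    · simpa using h01
    · have := hne.resolve_left (not_not.2 h01)
      simpa [h01, show (-1 : Fin 3) = 2 from rfl] using this.symm
  · have h12 := sub_eq_zero.1 h12
    exact ⟨_, h.isStationary_one, h.not_isStable_one_of_eq h12 (hne.resolve_right (not_not.2 h12))⟩

theorem adT_eq_neg_ad (h : L.IsMilnorFrame b l) (h01 : l 0 = l 1) (h12 : l 1 = l 2) (X : g) :
    L.adT X = -L.ad X := by
  ext Y
  refine ext_inner_right ℝ fun Z ↦ ?_
  rw [inner_adT, LinearMap.neg_apply, inner_neg_left, real_inner_comm, ad, real_inner_comm,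
    real_inner_comm Z, h.inner_bracket, h.inner_bracket, h01, h12]
  ring

end IsMilnorFrame

end LieStructure

namespace LieStructure

variable {g : Type*} [NormedAddCommGroup g] [InnerProductSpace ℝ g]
variable (L : LieStructure g)

theorem trace_ad_eq_sum {ι : Type*} [Fintype ι] (b : OrthonormalBasis ι ℝ g) (X : g) :
    LinearMap.trace ℝ g (L.ad X) = ∑ i, ⟪b i, L.bracket X (b i)⟫_ℝ :=
  LinearMap.trace_eq_sum_inner _ b

theorem trace_ad_bracket (X Y : g) : LinearMap.trace ℝ g (L.ad (L.bracket X Y)) = 0 := by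
  have h : L.ad (L.bracket X Y) = L.ad X * L.ad Y - L.ad Y * L.ad X := by
    ext Z
    have hj := L.jacobi X Y Z
    rw [L.bracket_swap X Z, map_neg, L.bracket_swap (L.bracket X Y) Z] at hj
    simp only [ad, LinearMap.sub_apply, Module.End.mul_apply]
    exact (sub_eq_zero.1 (by rw [← hj]; abel)).symm
  rw [h, map_sub, LinearMap.trace_mul_comm, sub_self]

variable [FiniteDimensional ℝ g]

/-- A three-dimensional unimodular metric Lie algebra has a Milnor frame. -/
theorem IsUnimodular.exists_isMilnorFrame {L : LieStructure g} (hL : L.IsUnimodular)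
    (hdim : Module.finrank ℝ g = 3) :
    ∃ b l, L.IsMilnorFrame b l ∧ 0 ≤ (l 0 - l 1) * (l 1 - l 2) := by
  let f : OrthonormalBasis (Fin 3) ℝ g := (stdOrthonormalBasis ℝ g).reindex (finCongr hdim)
  let A : g →ₗ[ℝ] g := f.toBasis.constr ℝ
    ![L.bracket (f 1) (f 2), L.bracket (f 2) (f 0), L.bracket (f 0) (f 1)]
  have hA0 : A (f 0) = L.bracket (f 1) (f 2) := by
    rw [← f.coe_toBasis]; exact f.toBasis.constr_basis ℝ _ 0
  have hA1 : A (f 1) = L.bracket (f 2) (f 0) := by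
    rw [← f.coe_toBasis]; exact f.toBasis.constr_basis ℝ _ 1
  have hA2 : A (f 2) = L.bracket (f 0) (f 1) := by
    rw [← f.coe_toBasis]; exact f.toBasis.constr_basis ℝ _ 2
  have htr : ∀ k, ∑ i, ⟪f i, L.bracket (f k) (f i)⟫_ℝ = 0 := fun k ↦ by
    rw [← trace_ad_eq_sum, hL]
  have h0 := htr 0
  have h1 := htr 1
  have h2 := htr 2
  simp only [Fin.sum_univ_three, L.bracket_self, inner_zero_right, L.bracket_swap (f 2) (f 0),
    L.bracket_swap (f 0) (f 1), L.bracket_swap (f 1) (f 2), ← hA0, ← hA1, ← hA2,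
    inner_neg_right, real_inner_comm (A _)] at h0 h1 h2
  have hsymm : A.IsSymmetric := by
    intro x y
    rw [← f.sum_repr' x, ← f.sum_repr' y]
    simp only [Fin.sum_univ_three, map_add, map_smul, inner_add_left, inner_add_right,
      real_inner_smul_left, real_inner_smul_right, real_inner_comm (A _)]
    linear_combination (⟪f 2, x⟫_ℝ * ⟪f 1, y⟫_ℝ - ⟪f 1, x⟫_ℝ * ⟪f 2, y⟫_ℝ) * h0 +
      (⟪f 0, x⟫_ℝ * ⟪f 2, y⟫_ℝ - ⟪f 2, x⟫_ℝ * ⟪f 0, y⟫_ℝ) * h1 +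
      (⟪f 1, x⟫_ℝ * ⟪f 0, y⟫_ℝ - ⟪f 0, x⟫_ℝ * ⟪f 1, y⟫_ℝ) * h2
  let c : g → g → g := fun u v ↦
    (⟪f 1, u⟫_ℝ * ⟪f 2, v⟫_ℝ - ⟪f 2, u⟫_ℝ * ⟪f 1, v⟫_ℝ) • f 0 +
    (⟪f 2, u⟫_ℝ * ⟪f 0, v⟫_ℝ - ⟪f 0, u⟫_ℝ * ⟪f 2, v⟫_ℝ) • f 1 +
    (⟪f 0, u⟫_ℝ * ⟪f 1, v⟫_ℝ - ⟪f 1, u⟫_ℝ * ⟪f 0, v⟫_ℝ) • f 2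
  have hbr : ∀ u v, L.bracket u v = A (c u v) := by
    intro u v
    refine ext_inner_left ℝ fun w ↦ ?_
    rw [L.inner_bracket_eq_sum f]
    simp only [c, Fin.sum_univ_three, L.bracket_self, L.bracket_swap (f 2) (f 0),
      L.bracket_swap (f 0) (f 1), L.bracket_swap (f 1) (f 2), ← hA0, ← hA1, ← hA2, map_add,
      map_smul, inner_add_right, inner_neg_right, inner_zero_right, real_inner_smul_right]
    ring
  let e := hsymm.eigenvectorBasis hdim
  let m := hsymm.eigenvalues hdim
  have hm : Antitone m := hsymm.eigenvalues_antitone hdim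
  have hAe : ∀ i, A (e i) = m i • e i := hsymm.apply_eigenvectorBasis hdim
  let ε := ⟪e 2, c (e 0) (e 1)⟫_ℝ
  have h12 : c (e 1) (e 2) = ε • e 0 := by
    rw [← e.sum_repr' (c (e 1) (e 2))]
    simp only [Fin.sum_univ_three, c, ε, inner_add_right, real_inner_smul_right,
      real_inner_comm (f _)]
    module
  have h20 : c (e 2) (e 0) = ε • e 1 := by
    rw [← e.sum_repr' (c (e 2) (e 0))]
    simp only [Fin.sum_univ_three, c, ε, inner_add_right, real_inner_smul_right,
      real_inner_comm (f _)]
    module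
  have h01 : c (e 0) (e 1) = ε • e 2 := by
    rw [← e.sum_repr' (c (e 0) (e 1))]
    simp only [Fin.sum_univ_three, c, ε, inner_add_right, real_inner_smul_right,
      real_inner_comm (f _)]
    module
  refine ⟨e, fun i ↦ ε * m i, ⟨?_, ?_, ?_⟩, ?_⟩
  · rw [hbr, h12, map_smul, hAe, smul_smul]
  · rw [hbr, h20, map_smul, hAe, smul_smul]
  · rw [hbr, h01, map_smul, hAe, smul_smul]
  · have h10 : m 1 ≤ m 0 := hm (by decide)
    have h21 : m 2 ≤ m 1 := hm (by decide)
    have := mul_nonneg (mul_self_nonneg ε) (mul_nonneg (sub_nonneg.2 h10) (sub_nonneg.2 h21))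
    linarith

/-- For a linear planar system with matrix `p, q; r, s`, some nonzero quadratic form is scaled by
the trace along the flow. -/
theorem exists_quadratic_form_scaled_by_trace (p q r s : ℝ) : ∃ A B C u v : ℝ,
    A * u ^ 2 + B * (u * v) + C * v ^ 2 ≠ 0 ∧
    ∀ x y : ℝ, 2 * A * x * (p * x + q * y) + B * ((p * x + q * y) * y + x * (r * x + s * y)) +
      2 * C * y * (r * x + s * y) = (p + s) * (A * x ^ 2 + B * (x * y) + C * y ^ 2) := by
  by_cases hr : r = 0
  · by_cases hq : q = 0
    · by_cases hps : p = s
      · exact ⟨1, 0, 1, 1, 0, by norm_num, fun x y ↦ by subst hr hq hps; ring⟩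
      · exact ⟨r, s - p, -q, 1, 1, by simpa [hr, hq, sub_eq_zero] using Ne.symm hps,
          fun x y ↦ by ring⟩
    · exact ⟨r, s - p, -q, 0, 1, by simpa using hq, fun x y ↦ by ring⟩
  · exact ⟨r, s - p, -q, 1, 0, by simpa using hr, fun x y ↦ by ring⟩

theorem exists_unstable_of_not_isUnimodular (hL : ¬ L.IsUnimodular)
    (hdim : Module.finrank ℝ g = 3) : ∃ X, L.IsStationary X ∧ ¬ L.IsStable X := by
  let T : g →ₗ[ℝ] ℝ := LinearMap.trace ℝ g ∘ₗ L.bracket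
  let a : g := (InnerProductSpace.toDual ℝ g).symm (LinearMap.toContinuousLinearMap T)
  have ha : ∀ X, ⟪a, X⟫_ℝ = LinearMap.trace ℝ g (L.ad X) := fun X ↦
    InnerProductSpace.toDual_symm_apply
  have ha0 : a ≠ 0 := fun h ↦ hL fun X ↦ by rw [← ha, h, inner_zero_left]
  have hna : ‖a‖ ≠ 0 := norm_ne_zero_iff.2 ha0
  obtain ⟨b, hb⟩ := Orthonormal.exists_orthonormalBasis_extension_of_card_eq (𝕜 := ℝ)
    (ι := Fin 3) (by simpa using hdim) (v := fun _ ↦ ‖a‖⁻¹ • a) (s := {2}) (by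
      refine ⟨fun _ ↦ ?_, fun i j hij ↦ (hij (Subsingleton.elim _ _)).elim⟩
      simp [norm_smul, hna])
  have hb2 : b 2 = ‖a‖⁻¹ • a := hb 2 rfl
  have hab : a = ‖a‖ • b 2 := by rw [hb2, smul_inv_smul₀ hna]
  have hcomm : ∀ X Y, ⟪b 2, L.bracket X Y⟫_ℝ = 0 := fun X Y ↦ by
    rw [hb2, real_inner_smul_left, ha, trace_ad_bracket, mul_zero]
  have htr : ∀ X, ⟪b 0, L.bracket X (b 0)⟫_ℝ + ⟪b 1, L.bracket X (b 1)⟫_ℝ = ‖a‖ * ⟪b 2, X⟫_ℝ := by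
    intro X
    have := L.trace_ad_eq_sum b X
    rw [← ha, hab, real_inner_smul_left, Fin.sum_univ_three, hcomm, add_zero] at this
    simpa [norm_smul] using this.symm
  have h01 : L.bracket (b 0) (b 1) = 0 := by
    have h0 := htr (b 0)
    have h1 := htr (b 1)
    rw [L.bracket_swap (b 0) (b 1)] at h1
    simp [L.bracket_self] at h0 h1
    rw [← b.sum_repr' (L.bracket (b 0) (b 1)), Fin.sum_univ_three, hcomm, h0, h1]
    simp
  set p := ⟪b 0, L.bracket (b 2) (b 0)⟫_ℝ with hp
  set q := ⟪b 1, L.bracket (b 2) (b 0)⟫_ℝ with hq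
  set r := ⟪b 0, L.bracket (b 2) (b 1)⟫_ℝ with hr
  set s := ⟪b 1, L.bracket (b 2) (b 1)⟫_ℝ with hs
  have hps : p + s = ‖a‖ := by simpa using htr (b 2)
  have hpos : 0 < p + s := by rw [hps]; positivity
  have hbr : ∀ Y Z, ⟪Y, L.bracket Y Z⟫_ℝ =
      (⟪b 2, Y⟫_ℝ * ⟪b 0, Z⟫_ℝ - ⟪b 0, Y⟫_ℝ * ⟪b 2, Z⟫_ℝ) * (p * ⟪b 0, Y⟫_ℝ + q * ⟪b 1, Y⟫_ℝ) +
      (⟪b 2, Y⟫_ℝ * ⟪b 1, Z⟫_ℝ - ⟪b 1, Y⟫_ℝ * ⟪b 2, Z⟫_ℝ) * (r * ⟪b 0, Y⟫_ℝ + s * ⟪b 1, Y⟫_ℝ) := by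
    intro Y Z
    have key : ∀ X, ⟪Y, L.bracket (b 2) X⟫_ℝ = ⟪b 0, Y⟫_ℝ * ⟪b 0, L.bracket (b 2) X⟫_ℝ +
        ⟪b 1, Y⟫_ℝ * ⟪b 1, L.bracket (b 2) X⟫_ℝ := fun X ↦ by
      conv_lhs => rw [← b.sum_repr' Y]
      simp only [Fin.sum_univ_three, inner_add_left, real_inner_smul_left, hcomm]
      ring
    rw [L.inner_bracket_eq_sum b]
    simp only [Fin.sum_univ_three, L.bracket_self, L.bracket_swap (b 2) (b 0),
      L.bracket_swap (b 2) (b 1), L.bracket_swap (b 0) (b 1), h01, key, inner_neg_right,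
      inner_zero_right, neg_zero, ← hp, ← hq, ← hr, ← hs]
    ring
  obtain ⟨A, B, C, u, v, huv, hABC⟩ := exists_quadratic_form_scaled_by_trace p q r s
  refine ⟨b 2, ?_, ?_⟩
  · rw [IsStationary, L.adT_self_eq_sum b]
    simp [hcomm]
  refine L.not_isStable_of_growth (w := u • b 0 + v • b 1) (c := (p + s) / 2) (ε := 1 / 2)
    (P := fun Y ↦ A * ⟪b 0, Y⟫_ℝ ^ 2 + B * (⟪b 0, Y⟫_ℝ * ⟪b 1, Y⟫_ℝ) + C * ⟪b 1, Y⟫_ℝ ^ 2)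
    (κ := fun Y ↦ (p + s) * ⟪b 2, Y⟫_ℝ)
    (by norm_num) (by positivity) (by fun_prop) (fun Y hY t ↦ ?_) (fun y hy ↦ ?_) fun k hk ↦ ?_
  · have hx := hY.hasDerivAt_inner (b 0) t
    have hy := hY.hasDerivAt_inner (b 1) t
    refine ((((hx.pow 2).const_mul A).add ((hx.mul hy).const_mul B)).add
      ((hy.pow 2).const_mul C)).congr_deriv ?_
    simp only [hbr, OrthonormalBasis.inner_eq_ite]
    simp
    linear_combination ⟪b 2, Y t⟫_ℝ * hABC ⟪b 0, Y t⟫_ℝ ⟪b 1, Y t⟫_ℝ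
  · have h1 := (abs_real_inner_le_norm (b 2) (y - b 2)).trans_lt (by simpa using hy)
    rw [inner_sub_right, real_inner_self_eq_norm_sq, b.norm_eq_one] at h1
    nlinarith [(abs_lt.1 h1).1]
  · simp only [inner_add_right, real_inner_smul_right, OrthonormalBasis.inner_eq_ite]
    simp only [Fin.isValue, Fin.reduceEq, if_true, if_false]
    refine ne_of_eq_of_ne ?_ (mul_ne_zero (pow_ne_zero 2 hk) huv)
    ring

end LieStructure

/-- A 3-dimensional metric Lie algebra whose inner product is not bi-invariant has an
unstable stationary point. -/
theorem exists_unstable_stationary_dim3    {g : Type*} [NormedAddCommGroup g] [InnerProductSpace ℝ g] [FiniteDimensional ℝ g]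
    (L : LieStructure g) (hdim : Module.finrank ℝ g = 3)
    (hnotbi : ∃ X₀ : g, L.adT X₀ ≠ -(L.ad X₀)) :
    ∃ X : g, L.IsStationary X ∧ ¬ L.IsStable X := by
  by_cases hL : L.IsUnimodular
  · obtain ⟨b, l, h, hl⟩ := hL.exists_isMilnorFrame hdim
    refine h.exists_unstable hl ?_
    by_contra! hne
    obtain ⟨X₀, hX₀⟩ := hnotbi
    exact hX₀ (h.adT_eq_neg_ad hne.1 hne.2 X₀)
  · exact L.exists_unstable_of_not_isUnimodular hL hdim
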